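/- In PG(n,q), with n ≥ 4, every plane blocking set K of type (a,b,c)_{n-1} with a = θ_{n-3}, b = θ_{n-2} + q^{n−3} and c = θ_{n-2} + q^{n−2} is a hyperoval cone: there exist an (n−3)-dimensional subspace V ⊆ K and a plane τ disjoint from V such that K ∩ τ is a hyperoval of τ and K is the union of V together with all points on lines joining a point of V to a point of K ∩ τ. -/

import Mathlib

open Module Set

noncomputable section

variable (F : Type) [Field F]

/-- The point set of `PG(n,q)`: the projectivization of `GF(q)^{n+1}`. -/
abbrev PGPoint (n : ℕ) := Projectivization F (Fin (n + 1) → F)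

/-- The set of points of the projective space lying in (the projectivization of)
a linear subspace `W`. A `d`-dimensional projective subspace corresponds to a
submodule `W` with `finrank F W = d + 1`; hyperplanes correspond to `finrank F W = n`. -/
def projSet (n : ℕ) (W : Submodule F (Fin (n + 1) → F)) : Set (PGPoint F n) :=
  {x | x.submodule ≤ W}

/-- `θ_m = (q^{m+1} - 1)/(q - 1)`, the number of points of `PG(m,q)`. -/
def theta (q m : ℕ) : ℕ := (q ^ (m + 1) - 1) / (q - 1)

/-- `K` is of type `(a,b,c)_{n-1}`: every hyperplane meets `K` in `a`, `b` or `c`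
points, and each of the three values is attained by some hyperplane. -/
def IsType3 (n : ℕ) (K : Set (PGPoint F n)) (a b c : ℕ) : Prop :=
  (∀ W : Submodule F (Fin (n + 1) → F), finrank F W = n →
      (K ∩ projSet F n W).ncard = a ∨ (K ∩ projSet F n W).ncard = b ∨
        (K ∩ projSet F n W).ncard = c) ∧
  (∃ W : Submodule F (Fin (n + 1) → F), finrank F W = n ∧ (K ∩ projSet F n W).ncard = a) ∧
  (∃ W : Submodule F (Fin (n + 1) → F), finrank F W = n ∧ (K ∩ projSet F n W).ncard = b) ∧
  (∃ W : Submodule F (Fin (n + 1) → F), finrank F W = n ∧ (K ∩ projSet F n W).ncard = c)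

/-- `tnum K m`: the number of hyperplanes meeting `K` in exactly `m` points. -/
def tnum (n : ℕ) (K : Set (PGPoint F n)) (m : ℕ) : ℕ :=
  {W : Submodule F (Fin (n + 1) → F) | finrank F W = n ∧ (K ∩ projSet F n W).ncard = m}.ncard

/-- `K` blocks every `t`-dimensional projective subspace of `PG(n,q)`,
i.e. `K` is an `(n-t)`-blocking set. -/
def BlocksDim (n t : ℕ) (K : Set (PGPoint F n)) : Prop :=
  ∀ W : Submodule F (Fin (n + 1) → F), finrank F W = t + 1 → (K ∩ projSet F n W).Nonempty

/-- `A` is a hyperoval of the plane (rank-3 subspace) `Wt` of `PG(n,q)`: a set of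
`q + 2` points of the plane meeting every line of the plane in exactly `0` or `2`
points. -/
def IsHyperoval (n q : ℕ) (Wt : Submodule F (Fin (n + 1) → F)) (A : Set (PGPoint F n)) : Prop :=
  A ⊆ projSet F n Wt ∧ A.ncard = q + 2 ∧
  ∀ L : Submodule F (Fin (n + 1) → F), L ≤ Wt → finrank F L = 2 →
    (A ∩ projSet F n L).ncard = 0 ∨ (A ∩ projSet F n L).ncard = 2

/-- `A` is a maximal arc of degree `d` in the plane (rank-3 subspace) `Wt` of `PG(n,q)`:
a nonempty set of points of the plane meeting every line of the plane in exactly `0`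
or `d` points. -/
def IsMaximalArc (n d : ℕ) (Wt : Submodule F (Fin (n + 1) → F)) (A : Set (PGPoint F n)) : Prop :=
  A ⊆ projSet F n Wt ∧ A.Nonempty ∧
  ∀ L : Submodule F (Fin (n + 1) → F), L ≤ Wt → finrank F L = 2 →
    (A ∩ projSet F n L).ncard = 0 ∨ (A ∩ projSet F n L).ncard = d

section Cone

variable {F} {E : Type*} [AddCommGroup E] [Module F E]

/-- The vectors of `E` that are zero or span a point of `K`. -/
def coneOf (K : Set (Projectivization F E)) : Set E :=
  {v | ∀ h : v ≠ 0, Projectivization.mk F v h ∈ K}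

theorem zero_mem_coneOf (K : Set (Projectivization F E)) : (0 : E) ∈ coneOf K :=
  fun h => absurd rfl h

theorem smul_mem_coneOf {K : Set (Projectivization F E)} (r : F) {v : E} (hv : v ∈ coneOf K) :
    r • v ∈ coneOf K := by
  intro h
  have hv0 : v ≠ 0 := by rintro rfl; simp at h
  have : Projectivization.mk F (r • v) h = Projectivization.mk F v hv0 :=
    (Projectivization.mk_eq_mk_iff' F _ _ _ _).2 ⟨r, rfl⟩
  rw [this]
  exact hv hv0

theorem rep_mem_coneOf {K : Set (Projectivization F E)} {p : Projectivization F E} :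
    p.rep ∈ coneOf K ↔ p ∈ K := by
  constructor
  · intro h
    simpa using h p.rep_nonzero
  · intro h _
    simpa using h

theorem ncard_coneOf [Fintype F] [Finite E] (K : Set (Projectivization F E)) :
    (coneOf K).ncard = K.ncard * (Fintype.card F - 1) + 1 := by
  classical
  have himage : coneOf K =
      insert 0 ((fun x : Projectivization F E × Fˣ => x.2 • x.1.rep) '' (K ×ˢ univ)) := by
    ext v
    simp only [mem_insert_iff, mem_image, mem_prod, mem_univ, and_true, Prod.exists]
    constructor
    · intro hv
      by_cases h : v = 0
      · exact Or.inl h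
      · right
        obtain ⟨a, ha⟩ := Projectivization.exists_smul_eq_mk_rep F v h
        exact ⟨_, a⁻¹, hv h, by rw [← ha, inv_smul_smul]⟩
    · rintro (rfl | ⟨p, u, hp, rfl⟩)
      · exact zero_mem_coneOf K
      · exact smul_mem_coneOf (u : F) (rep_mem_coneOf.2 hp)
  have hinj : Function.Injective (fun x : Projectivization F E × Fˣ => x.2 • x.1.rep) := by
    rintro ⟨p, u⟩ ⟨p', u'⟩ h
    simp only at h
    have hp : p = p' := by
      rw [← p.mk_rep, ← p'.mk_rep, Projectivization.mk_eq_mk_iff]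
      refine ⟨u⁻¹ * u', ?_⟩
      rw [mul_smul, ← h, inv_smul_smul]
    subst hp
    have h' : (u : F) • p.rep = (u' : F) • p.rep := h
    have := smul_left_injective F p.rep_nonzero h'
    rw [Units.ext this]
  rw [himage, ncard_insert_of_notMem, ncard_image_of_injective _ hinj, ncard_prod,
    ncard_univ, Nat.card_eq_fintype_card, Fintype.card_units]
  rintro ⟨⟨p, u⟩, -, h⟩
  exact p.rep_nonzero ((smul_eq_zero_iff_eq u).1 h)

theorem coneOf_inter_submodule (K : Set (Projectivization F E)) (W : Submodule F E) :
    coneOf (K ∩ {x | x.submodule ≤ W}) = coneOf K ∩ W := by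
  ext v
  by_cases hv : v = 0
  · subst hv
    simp [zero_mem_coneOf]
  · simp [coneOf, hv, Projectivization.submodule_mk]

/-- The hyperplanes of a pencil: every vector off the axis lies in exactly one of them. -/
theorem ncard_add_card_mul_ncard_axis [Fintype F] [Finite E] (C : Set E) (f g : Dual F E) :
    C.ncard + Fintype.card F * {v ∈ C | f v = 0 ∧ g v = 0}.ncard =
      {v ∈ C | f v = 0}.ncard + ∑ t : F, {v ∈ C | (g + t • f) v = 0}.ncard := by
  classical
  have := Fintype.ofFinite E
  have hc : ∀ p : E → Prop, {v ∈ C | p v}.ncard = ∑ v ∈ C.toFinset, if p v then 1 else 0 := by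
    intro p
    rw [← Finset.card_filter, ← ncard_coe_finset]
    congr 1
    ext v
    simp
  have hC : C.ncard = ∑ v ∈ C.toFinset, 1 := by
    rw [← Finset.card_eq_sum_ones, ← ncard_coe_finset]
    simp
  simp only [hc]
  rw [hC, Finset.sum_comm, Finset.mul_sum, ← Finset.sum_add_distrib, ← Finset.sum_add_distrib]
  refine Finset.sum_congr rfl fun v _ => ?_
  by_cases hf : f v = 0
  · by_cases hg : g v = 0 <;> simp [hf, hg]
  · have : ∀ t : F, (g + t • f) v = 0 ↔ t = -g v / f v := by
      intro t
      simp only [LinearMap.add_apply, LinearMap.smul_apply, smul_eq_mul]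
      rw [eq_div_iff hf]
      constructor <;> intro h <;> linear_combination h
    simp only [this]
    simp [hf]

theorem exists_submodule_finrank_eq_of_le [FiniteDimensional F E] (U : Submodule F E) {k : ℕ}
    (hk : k ≤ finrank F U) : ∃ W ≤ U, finrank F W = k := by
  obtain ⟨v, hv⟩ := exists_linearIndependent_of_le_finrank hk
  have hv' : LinearIndependent F (fun i => (v i : E)) := hv.map' U.subtype U.ker_subtype
  refine ⟨Submodule.span F (range fun i => (v i : E)), ?_, ?_⟩
  · rw [Submodule.span_le]
    rintro _ ⟨i, rfl⟩
    exact (v i).2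
  · simpa using finrank_span_eq_card hv'

/-- Equality in the Bose–Burton bound: a smallest cone meeting all subspaces of rank `3` is a
subspace. -/
theorem exists_submodule_eq_of_ncard_eq [Fintype F] [Finite E] {C : Set E} (h0 : (0 : E) ∈ C)
    (hC : ∀ (r : F), ∀ v ∈ C, r • v ∈ C)
    (hblock : ∀ W : Submodule F E, finrank F W = 3 → ∃ v ∈ C, v ∈ W ∧ v ≠ 0)
    {d : ℕ} (hd : finrank F E = d + 2) (hcard : C.ncard = Fintype.card F ^ d) :
    ∃ V : Submodule F E, (V : Set E) = C := by
  have hadd : ∀ x ∈ C, ∀ y ∈ C, x + y ∈ C := by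
    intro x hx y hy
    by_contra hz
    let P : Submodule F E → Prop := fun U => x + y ∈ U ∧ ∀ v ∈ C, v ∈ U → v = 0
    have hP : P (Submodule.span F {x + y}) := by
      refine ⟨Submodule.mem_span_singleton_self _, fun v hv hvs => ?_⟩
      obtain ⟨r, rfl⟩ := Submodule.mem_span_singleton.1 hvs
      by_cases hr : r = 0
      · simp [hr]
      · exact absurd (by simpa [smul_smul, hr] using hC r⁻¹ _ hv) hz
    obtain ⟨U, -, hU⟩ := (Set.toFinite {U | P U}).exists_le_maximal hP
    have hrank : finrank F U ≤ 2 := by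
      by_contra! h
      obtain ⟨W, hWU, hW⟩ := exists_submodule_finrank_eq_of_le U (k := 3) h
      obtain ⟨v, hv, hvW, hv0⟩ := hblock W hW
      exact hv0 (hU.prop.2 v hv (hWU hvW))
    have hsurj : U.mkQ '' C = univ := by
      refine eq_univ_of_forall fun e => ?_
      obtain ⟨e, rfl⟩ := U.mkQ_surjective e
      by_cases he : e ∈ U
      · exact ⟨0, h0, by simpa using ((Submodule.Quotient.mk_eq_zero U).2 he).symm⟩
      · have : ∃ v ∈ C, v ∈ U ⊔ Submodule.span F {e} ∧ v ≠ 0 := by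
          by_contra! h
          have hle := hU.le_of_ge (y := U ⊔ Submodule.span F {e})
            ⟨Submodule.mem_sup_left hU.prop.1, h⟩ le_sup_left
          exact he (hle (Submodule.mem_sup_right (Submodule.mem_span_singleton_self e)))
        obtain ⟨v, hv, hvU, hv0⟩ := this
        obtain ⟨u, hu, w, hw, rfl⟩ := Submodule.mem_sup.1 hvU
        obtain ⟨r, rfl⟩ := Submodule.mem_span_singleton.1 hw
        have hr : r ≠ 0 := by
          rintro rfl
          exact hv0 (hU.prop.2 _ hv (by simpa using hu))
        refine ⟨r⁻¹ • (u + r • e), hC _ _ hv, ?_⟩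
        have : U.mkQ u = 0 := (Submodule.Quotient.mk_eq_zero U).2 hu
        rw [map_smul, map_add, map_smul, this, zero_add, smul_smul, inv_mul_cancel₀ hr, one_smul]
    have hquot : C.ncard ≤ (U.mkQ '' C).ncard := by
      have hfin := U.finrank_quotient_add_finrank
      rw [hsurj, ncard_univ, Module.natCard_eq_pow_finrank (K := F), Nat.card_eq_fintype_card,
        hcard]
      exact Nat.pow_le_pow_right Fintype.card_pos (by omega)
    have hinj : InjOn U.mkQ C :=
      injOn_of_ncard_image_eq (le_antisymm (ncard_image_le (toFinite C)) hquot)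
    have hxy : x = -y := by
      refine hinj hx (by simpa using hC (-1) y hy) ?_
      have := (Submodule.Quotient.mk_eq_zero U).2 hU.prop.1
      rw [map_neg, eq_neg_iff_add_eq_zero, ← map_add]
      exact this
    exact hz (by simpa [hxy] using h0)
  let V : Submodule F E :=
    { carrier := C
      add_mem' := fun hx hy => hadd _ hx _ hy
      zero_mem' := h0
      smul_mem' := fun r v hv => hC r v hv }
  exact ⟨V, rfl⟩

theorem exists_submodule_eq_inter [Fintype F] [Finite E] {C : Set E} (h0 : (0 : E) ∈ C)
    (hC : ∀ (r : F), ∀ v ∈ C, r • v ∈ C)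
    (hblock : ∀ W : Submodule F E, finrank F W = 3 → ∃ v ∈ C, v ∈ W ∧ v ≠ 0)
    {d : ℕ} (H : Submodule F E) (hd : finrank F H = d + 2)
    (hcard : (C ∩ H).ncard = Fintype.card F ^ d) :
    ∃ V : Submodule F E, (V : Set E) = C ∩ H ∧ finrank F V = d := by
  have himage : H.subtype '' (H.subtype ⁻¹' C) = C ∩ H := by
    rw [image_preimage_eq_inter_range]
    simp
  obtain ⟨V, hV⟩ := exists_submodule_eq_of_ncard_eq (C := H.subtype ⁻¹' C) (by simpa using h0)
    (fun r v hv => by simpa using hC r _ hv)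
    (fun W hW => by
      obtain ⟨v, hv, hvW, hv0⟩ := hblock (W.map H.subtype)
        (by rw [← hW]; exact (Submodule.equivSubtypeMap H W).finrank_eq.symm)
      obtain ⟨w, hw, rfl⟩ := hvW
      exact ⟨w, hv, hw, by rintro rfl; simp at hv0⟩)
    hd (by rw [← hcard, ← himage, ncard_image_of_injective _ H.injective_subtype])
  have hcoe : ((V.map H.subtype : Submodule F E) : Set E) = C ∩ H := by
    rw [Submodule.map_coe, hV, himage]
  refine ⟨V.map H.subtype, hcoe, ?_⟩
  have hc := Module.natCard_eq_pow_finrank (K := F) (V := V.map H.subtype)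
  have : Nat.card (V.map H.subtype) = (C ∩ H).ncard := by
    rw [← hcoe]; rfl
  rw [this, hcard, Nat.card_eq_fintype_card] at hc
  exact (Nat.pow_right_injective Fintype.one_lt_card hc).symm

/-- The number of vectors of `C` in the hyperplane `f = 0`. -/
def kerCount (C : Set E) (f : Dual F E) : ℕ := {v ∈ C | f v = 0}.ncard

theorem card_add_kerCount_eq_sum [Fintype F] [Finite E] (C : Set E) (f g : Dual F E) :
    C.ncard + Fintype.card F * {v ∈ C | f v = 0 ∧ g v = 0}.ncard =
      kerCount C f + ∑ t : F, kerCount C (g + t • f) :=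
  ncard_add_card_mul_ncard_axis C f g

theorem kerCount_smul (C : Set E) (f : Dual F E) {r : F} (hr : r ≠ 0) :
    kerCount C (r • f) = kerCount C f := by
  simp [kerCount, hr]

theorem sum_eq_of_three_values {ι : Type*} [Fintype ι] (N : ι → ℕ) {A x y : ℕ}
    (hx : 0 < x) (hxy : x < y) (h : ∀ i, N i = A ∨ N i = A + x ∨ N i = A + y) :
    ∃ β γ : ℕ, β + γ ≤ Fintype.card ι ∧ ∑ i, N i = Fintype.card ι * A + β * x + γ * y ∧
      (β = 0 → ∀ i, N i ≠ A + x) ∧ (β = Fintype.card ι → ∀ i, N i = A + x) ∧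
      (β + γ < Fintype.card ι → ∃ i, N i = A) := by
  classical
  refine ⟨(Finset.univ.filter fun i => N i = A + x).card,
    (Finset.univ.filter fun i => N i = A + y).card, ?_, ?_, ?_, ?_, ?_⟩
  · rw [← Finset.card_union_of_disjoint]
    · exact Finset.card_le_univ _
    · rw [Finset.disjoint_filter]
      intros
      omega
  · have : ∀ i, N i = A + (if N i = A + x then 1 else 0) * x +
        (if N i = A + y then 1 else 0) * y := by
      intro i
      rcases h i with h | h | h <;> rw [h] <;> split_ifs <;> omega
    rw [Finset.sum_congr rfl fun i _ => this i]
    simp only [Finset.sum_add_distrib, ← Finset.sum_mul]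
    simp
  · intro h0 i hi
    have : i ∈ Finset.univ.filter fun i => N i = A + x := by simp [hi]
    rw [Finset.card_eq_zero.1 h0] at this
    simp at this
  · intro h1 i
    have : i ∈ Finset.univ.filter fun i => N i = A + x := by
      rw [Finset.eq_univ_of_card _ h1]
      exact Finset.mem_univ i
    simpa using this
  · intro hlt
    by_contra! hne
    rw [← Finset.card_union_of_disjoint] at hlt
    · refine hlt.ne ?_
      rw [← Finset.card_univ]
      congr 1
      ext i
      have := h i
      have := hne i
      simp only [Finset.mem_union, Finset.mem_filter, Finset.mem_univ, true_and, iff_true]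
      tauto
    · rw [Finset.disjoint_filter]
      intros
      omega

theorem pencil_arithmetic {q β γ β' γ' : ℕ} (hq : 2 ≤ q) (h : β + γ ≤ q) (h' : β' + γ' ≤ q)
    (heq : β * (q + 1) + γ * (2 * q) = q + β' * (q + 1) + γ' * (2 * q)) :
    (β = 0 ∧ q + β' * (q + 1) + γ' * (2 * q) = q ^ 2 + 2 * q) ∨
      (β = q ∧ β' = 0 ∧ γ' < q ∧ q + β' * (q + 1) + γ' * (2 * q) = q ^ 2 + q) := by
  obtain ⟨k, hk⟩ : ∃ k : ℤ, k = 1 + 2 * γ' + β' - 2 * γ - β := ⟨_, rfl⟩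
  have heq' : (β : ℤ) * (q + 1) + γ * (2 * q) = q + β' * (q + 1) + γ' * (2 * q) := by
    exact_mod_cast heq
  have hdiff : (β : ℤ) - β' = q * k := by
    rw [hk]; linear_combination heq'
  have hk1 : k ≤ 1 := by
    by_contra! hc
    nlinarith
  have hk2 : -1 ≤ k := by
    by_contra! hc
    nlinarith
  obtain rfl | rfl | rfl : k = -1 ∨ k = 0 ∨ k = 1 := by omega
  · left
    have hβ : β = 0 := by omega
    have hβ' : β' = q := by omega
    have hγ' : γ' = 0 := by omega
    subst hβ hγ' hβ'
    exact ⟨rfl, by ring⟩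
  · omega
  · right
    have hβ : β = q := by omega
    have hβ' : β' = 0 := by omega
    have hγ : γ = 0 := by omega
    subst hβ' hγ hβ
    refine ⟨rfl, rfl, by omega, ?_⟩
    rw [← heq]
    ring

variable (F) in
/-- A cone of vectors over a plane blocking set whose hyperplane sections take the three
prescribed sizes. -/
structure IsThreeTypeCone [Fintype F] (C : Set E) (d : ℕ) : Prop where
  finrank_eq : finrank F E = d + 4
  zero_mem : (0 : E) ∈ C
  smul_mem : ∀ (r : F), ∀ v ∈ C, r • v ∈ C
  blocks : ∀ W : Submodule F E, finrank F W = 3 → ∃ v ∈ C, v ∈ W ∧ v ≠ 0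
  kerCount_eq : ∀ f : Dual F E, f ≠ 0 →
    kerCount C f = Fintype.card F ^ (d + 1) ∨
    kerCount C f = Fintype.card F ^ (d + 1) +
      (Fintype.card F + 1) * ((Fintype.card F - 1) * Fintype.card F ^ d) ∨
    kerCount C f = Fintype.card F ^ (d + 1) +
      2 * Fintype.card F * ((Fintype.card F - 1) * Fintype.card F ^ d)

theorem ncard_submodule [Fintype F] [Finite E] (V : Submodule F E) :
    (V : Set E).ncard = Fintype.card F ^ finrank F V := by
  rw [← Nat.card_eq_fintype_card, ← Module.natCard_eq_pow_finrank (K := F) (V := V)]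
  rfl

theorem finrank_inf_ker_add_one [FiniteDimensional F E] (V : Submodule F E) {g : Dual F E}
    (hg : ¬ V ≤ LinearMap.ker g) : finrank F ↥(V ⊓ LinearMap.ker g) + 1 = finrank F V := by
  have hne : g.comp V.subtype ≠ 0 := by
    intro h
    exact hg fun v hv => LinearMap.congr_fun h ⟨v, hv⟩
  have := Dual.finrank_ker_add_one_of_ne_zero (f := g.comp V.subtype) hne
  rw [← this, (Submodule.equivSubtypeMap V (g.comp V.subtype).ker).finrank_eq, LinearMap.ker_comp,
    Submodule.map_comap_subtype]

theorem exists_dual_ne [FiniteDimensional F E] (V : Submodule F E) (f : Dual F E)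
    (hV : finrank F V + 2 ≤ finrank F E) :
    ∃ g : Dual F E, V ≤ LinearMap.ker g ∧ ∀ r : F, g ≠ r • f := by
  by_contra! h
  have hle : V.dualAnnihilator ≤ Submodule.span F {f} := by
    intro g hg
    obtain ⟨r, rfl⟩ := h g fun v hv => (Submodule.mem_dualAnnihilator g).1 hg v hv
    exact Submodule.smul_mem _ r (Submodule.mem_span_singleton_self f)
  have h1 := Submodule.finrank_mono hle
  have h2 := finrank_span_le_card (R := F) ({f} : Set (Dual F E))
  have h3 := Subspace.finrank_add_finrank_dualAnnihilator_eq V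
  simp only [toFinset_singleton, Finset.card_singleton] at h2
  omega

namespace IsThreeTypeCone

variable [Fintype F] [Finite E] {C : Set E} {d : ℕ}

theorem dichotomy (hC : IsThreeTypeCone F C d) {f : Dual F E}
    {V : Submodule F E} (hV : (V : Set E) = {v ∈ C | f v = 0}) (hVrank : finrank F V = d + 1) :
    (C.ncard = Fintype.card F ^ (d + 1) + (Fintype.card F ^ 2 + 2 * Fintype.card F) *
        ((Fintype.card F - 1) * Fintype.card F ^ d) ∧
      ∀ g : Dual F E, g ≠ 0 → V ≤ LinearMap.ker g →
        kerCount C g ≠ Fintype.card F ^ (d + 1) +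
          (Fintype.card F + 1) * ((Fintype.card F - 1) * Fintype.card F ^ d)) ∨
    (C.ncard = Fintype.card F ^ (d + 1) + (Fintype.card F ^ 2 + Fintype.card F) *
        ((Fintype.card F - 1) * Fintype.card F ^ d) ∧
      (∀ g : Dual F E, V ≤ LinearMap.ker g → (∀ r : F, g ≠ r • f) →
        kerCount C g = Fintype.card F ^ (d + 1) +
          (Fintype.card F + 1) * ((Fintype.card F - 1) * Fintype.card F ^ d)) ∧
      ∀ g : Dual F E, ¬ V ≤ LinearMap.ker g →
        kerCount C g ≠ Fintype.card F ^ (d + 1) +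
          (Fintype.card F + 1) * ((Fintype.card F - 1) * Fintype.card F ^ d) ∧
        ∃ t : F, kerCount C (g + t • f) = Fintype.card F ^ (d + 1)) := by
  have hq : 2 ≤ Fintype.card F := Fintype.one_lt_card
  have hcount := hC.kerCount_eq
  have hCf : kerCount C f = Fintype.card F ^ (d + 1) := by
    rw [kerCount, ← hV, ncard_submodule, hVrank]
  set q := Fintype.card F with hqdef
  set u := (q - 1) * q ^ d with hu
  have hupos : 0 < u := Nat.mul_pos (by omega) (Nat.pow_pos (by omega))
  have hqu : q ^ (d + 1) = q ^ d + u := by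
    obtain ⟨m, hm⟩ : ∃ m, q = m + 1 := ⟨q - 1, by omega⟩
    rw [hu, hm, Nat.add_sub_cancel]
    ring
  have hlt : (q + 1) * u < 2 * q * u := Nat.mul_lt_mul_of_pos_right (by omega) hupos
  have haxis : ∀ g : Dual F E, {v ∈ C | f v = 0 ∧ g v = 0} =
      ((V ⊓ LinearMap.ker g : Submodule F E) : Set E) := by
    intro g
    rw [Submodule.coe_inf, hV]
    ext v
    simp only [mem_ofPred_eq, mem_inter_iff, SetLike.mem_coe, LinearMap.mem_ker]
    tauto
  have hne : ∀ g : Dual F E, (∀ r : F, g ≠ r • f) → ∀ t : F, g + t • f ≠ 0 := by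
    intro g hg t h
    exact hg (-t) ((eq_neg_of_add_eq_zero_left h).trans (neg_smul t f).symm)
  have hpencil : ∀ g : Dual F E, (∀ r : F, g ≠ r • f) → ∃ β γ : ℕ, β + γ ≤ q ∧
      ∑ t : F, kerCount C (g + t • f) = q * q ^ (d + 1) + β * ((q + 1) * u) + γ * (2 * q * u) ∧
      (β = 0 → ∀ t : F, kerCount C (g + t • f) ≠ q ^ (d + 1) + (q + 1) * u) ∧
      (β = q → ∀ t : F, kerCount C (g + t • f) = q ^ (d + 1) + (q + 1) * u) ∧
      (β + γ < q → ∃ t : F, kerCount C (g + t • f) = q ^ (d + 1)) := fun g hg =>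
    sum_eq_of_three_values (fun t : F => kerCount C (g + t • f))
      (Nat.mul_pos (by omega) hupos) hlt fun t => hcount _ (hne g hg t)
  have hin : ∀ g : Dual F E, V ≤ LinearMap.ker g → (∀ r : F, g ≠ r • f) →
      ∃ β γ : ℕ, β + γ ≤ q ∧
      C.ncard = q ^ (d + 1) + (β * (q + 1) + γ * (2 * q)) * u ∧
      (β = 0 → kerCount C g ≠ q ^ (d + 1) + (q + 1) * u) ∧
      (β = q → kerCount C g = q ^ (d + 1) + (q + 1) * u) := by
    intro g hgV hg
    obtain ⟨β, γ, h1, h2, h3, h4, -⟩ := hpencil g hg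
    refine ⟨β, γ, h1, ?_, fun h => by simpa using h3 h 0, fun h => by simpa using h4 h 0⟩
    have := card_add_kerCount_eq_sum C f g
    rw [haxis, inf_eq_left.2 hgV, ncard_submodule, hVrank, h2, hCf] at this
    linarith
  have hout : ∀ g : Dual F E, ¬ V ≤ LinearMap.ker g →
      ∃ β γ : ℕ, β + γ ≤ q ∧
      C.ncard = q ^ (d + 1) + (q + β * (q + 1) + γ * (2 * q)) * u ∧
      (β = 0 → kerCount C g ≠ q ^ (d + 1) + (q + 1) * u) ∧
      (β + γ < q → ∃ t : F, kerCount C (g + t • f) = q ^ (d + 1)) := by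
    intro g hgV
    have hg : ∀ r : F, g ≠ r • f := by
      rintro r rfl
      refine hgV fun v hv => ?_
      have : v ∈ {v ∈ C | f v = 0} := hV ▸ hv
      simp [this.2]
    obtain ⟨β, γ, h1, h2, h3, -, h5⟩ := hpencil g hg
    refine ⟨β, γ, h1, ?_, fun h => by simpa using h3 h 0, h5⟩
    have := card_add_kerCount_eq_sum C f g
    have hrank : finrank F ↥(V ⊓ LinearMap.ker g) = d := by
      have := finrank_inf_ker_add_one V hgV
      omega
    rw [haxis, ncard_submodule, hrank, h2, hCf, ← hqdef] at this
    have : C.ncard + q * q ^ d =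
        q ^ (d + 1) + q * q ^ d + (q + β * (q + 1) + γ * (2 * q)) * u := by
      rw [this]
      nth_rewrite 2 [hqu]
      ring
    omega
  obtain ⟨g₁, hg₁V, hg₁⟩ := exists_dual_ne V f (by rw [hVrank, hC.finrank_eq]; omega)
  obtain ⟨g₂, hg₂V⟩ : ∃ g : Dual F E, ¬ V ≤ LinearMap.ker g := by
    have : V ≠ ⊥ := by
      rintro rfl
      simp at hVrank
    obtain ⟨v, hv, hv0⟩ := Submodule.exists_mem_ne_zero_of_ne_bot this
    obtain ⟨g, hg⟩ : ∃ g : Dual F E, g v ≠ 0 := by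
      by_contra! h
      exact hv0 ((forall_dual_apply_eq_zero_iff F v).1 h)
    exact ⟨g, fun h => hg (h hv)⟩
  have hcompare : ∀ {β γ β' γ' : ℕ}, β + γ ≤ q → β' + γ' ≤ q →
      C.ncard = q ^ (d + 1) + (β * (q + 1) + γ * (2 * q)) * u →
      C.ncard = q ^ (d + 1) + (q + β' * (q + 1) + γ' * (2 * q)) * u →
      (β = 0 ∧ q + β' * (q + 1) + γ' * (2 * q) = q ^ 2 + 2 * q) ∨
      (β = q ∧ β' = 0 ∧ γ' < q ∧ q + β' * (q + 1) + γ' * (2 * q) = q ^ 2 + q) := by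
    intro β γ β' γ' h h' hc hc'
    exact pencil_arithmetic hq h h' (Nat.eq_of_mul_eq_mul_right hupos (by omega))
  obtain ⟨β₁, γ₁, h₁, hc₁, -, -⟩ := hin g₁ hg₁V hg₁
  obtain ⟨β₂, γ₂, h₂, hc₂, -, -⟩ := hout g₂ hg₂V
  rcases hcompare h₁ h₂ hc₁ hc₂ with ⟨-, hM⟩ | ⟨-, -, -, hM⟩
  · rw [hM] at hc₂
    refine Or.inl ⟨hc₂, fun g hg0 hgV => ?_⟩
    by_cases hg : ∀ r : F, g ≠ r • f
    · obtain ⟨β, γ, h, hc, hb, -⟩ := hin g hgV hg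
      rcases hcompare h h₂ hc (hM ▸ hc₂) with ⟨h0, -⟩ | ⟨-, -, -, hM'⟩
      · exact hb h0
      · nlinarith
    · push Not at hg
      obtain ⟨r, rfl⟩ := hg
      rw [kerCount_smul C f (left_ne_zero_of_smul hg0), hCf]
      have : 0 < (q + 1) * u := by positivity
      omega
  · rw [hM] at hc₂
    refine Or.inr ⟨hc₂, fun g hgV hg => ?_, fun g hgV => ?_⟩
    · obtain ⟨β, γ, h, hc, -, hb⟩ := hin g hgV hg
      rcases hcompare h h₂ hc (hM ▸ hc₂) with ⟨-, hM'⟩ | ⟨h0, -⟩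
      · nlinarith
      · exact hb h0
    · obtain ⟨β, γ, h, hc, hb, hex⟩ := hout g hgV
      rcases hcompare h₁ h hc₁ hc with ⟨-, hM'⟩ | ⟨-, h0, hlt', -⟩
      · rw [hM', hc₂] at hc
        have := Nat.eq_of_mul_eq_mul_right hupos (Nat.add_left_cancel hc)
        omega
      · exact ⟨hb h0, hex (by omega)⟩

theorem exists_vertex (hC : IsThreeTypeCone F C d) {f : Dual F E} (hf : f ≠ 0)
    (hCf : kerCount C f = Fintype.card F ^ (d + 1)) :
    ∃ V : Submodule F E, (V : Set E) = {v ∈ C | f v = 0} ∧ finrank F V = d + 1 := by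
  have hker := Dual.finrank_ker_add_one_of_ne_zero hf
  rw [hC.finrank_eq] at hker
  exact exists_submodule_eq_inter hC.zero_mem hC.smul_mem hC.blocks (LinearMap.ker f)
    (by omega) hCf

theorem ncard_eq (hC : IsThreeTypeCone F C d) {f : Dual F E}
    {V : Submodule F E} (hV : (V : Set E) = {v ∈ C | f v = 0}) (hVrank : finrank F V = d + 1) :
    C.ncard = Fintype.card F ^ (d + 1) + (Fintype.card F ^ 2 + 2 * Fintype.card F) *
        ((Fintype.card F - 1) * Fintype.card F ^ d) ∧
      ∀ g : Dual F E, g ≠ 0 → V ≤ LinearMap.ker g →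
        kerCount C g ≠ Fintype.card F ^ (d + 1) +
          (Fintype.card F + 1) * ((Fintype.card F - 1) * Fintype.card F ^ d) := by
  rcases hC.dichotomy hV hVrank with h | ⟨hcard, hin, hout⟩
  · exact h
  exfalso
  have hq : 2 ≤ Fintype.card F := Fintype.one_lt_card
  have hupos : 0 < (Fintype.card F - 1) * Fintype.card F ^ d :=
    Nat.mul_pos (by omega) (Nat.pow_pos (by omega))
  obtain ⟨g, hg⟩ : ∃ g : Dual F E, ¬ V ≤ LinearMap.ker g := by
    by_contra! h
    have : V = ⊥ := by
      rw [eq_bot_iff]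
      exact fun v hv => (forall_dual_apply_eq_zero_iff F v).1 fun g => h g hv
    rw [this, finrank_bot] at hVrank
    omega
  obtain ⟨-, t, ht⟩ := hout g hg
  have hf : V ≤ LinearMap.ker f := fun v hv => (hV ▸ hv : v ∈ {v ∈ C | f v = 0}).2
  have hf₁ : ¬ V ≤ LinearMap.ker (g + t • f) := by
    intro h
    refine hg fun v hv => ?_
    have h1 : f v = 0 := hf hv
    have h2 : (g + t • f) v = 0 := h hv
    simpa [h1] using h2
  have hf₁0 : g + t • f ≠ 0 := by
    intro h
    rw [h] at hf₁
    simp at hf₁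
  obtain ⟨V₁, hV₁, hV₁rank⟩ := hC.exists_vertex hf₁0 ht
  obtain ⟨-, hout₁⟩ : _ ∧ ∀ g : Dual F E, ¬ V₁ ≤ LinearMap.ker g →
        kerCount C g ≠ Fintype.card F ^ (d + 1) +
          (Fintype.card F + 1) * ((Fintype.card F - 1) * Fintype.card F ^ d) := by
    rcases hC.dichotomy hV₁ hV₁rank with ⟨hcard₁, -⟩ | ⟨hcard₁, -, h⟩
    · rw [hcard] at hcard₁
      have := Nat.eq_of_mul_eq_mul_right hupos (Nat.add_left_cancel hcard₁)
      omega
    · exact ⟨hcard₁, fun g hg => (h g hg).1⟩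
  have hne : ¬ V₁ ≤ V := by
    intro h
    have := Submodule.eq_of_le_of_finrank_eq h (by rw [hV₁rank, hVrank])
    rw [← this] at hf₁
    exact hf₁ fun v hv => (hV₁ ▸ hv : v ∈ {v ∈ C | (g + t • f) v = 0}).2
  obtain ⟨v, hv₁, hv⟩ := Set.not_subset.1 hne
  obtain ⟨g₂, hg₂v, hg₂⟩ := Submodule.exists_le_ker_of_notMem hv
  obtain ⟨g₁, hg₁V, hg₁⟩ := exists_dual_ne V f (by rw [hVrank, hC.finrank_eq]; omega)
  have hclash : ∀ k : Dual F E, V ≤ LinearMap.ker k → k v ≠ 0 → ∃ r : F, k = r • f := by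
    intro k hkV hkv
    by_contra! hk
    exact hout₁ k (fun h => hkv (h hv₁)) (hin k hkV hk)
  obtain ⟨r₂, hr₂⟩ := hclash g₂ hg₂ hg₂v
  by_cases hg₁v : g₁ v = 0
  · obtain ⟨r, hr⟩ := hclash (g₁ + g₂)
      (fun w hw => by
        have h1 : g₁ w = 0 := hg₁V hw
        have h2 : g₂ w = 0 := hg₂ hw
        simp [h1, h2]) (by simpa [hg₁v] using hg₂v)
    exact hg₁ (r - r₂) (by rw [sub_smul r r₂ f, ← hr, ← hr₂, add_sub_cancel_right])
  · obtain ⟨r, hr⟩ := hclash g₁ hg₁V hg₁v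
    exact hg₁ r hr

theorem sup_span_subset (hC : IsThreeTypeCone F C d) {f : Dual F E}
    {V : Submodule F E} (hV : (V : Set E) = {v ∈ C | f v = 0}) (hVrank : finrank F V = d + 1)
    {y : E} (hy : y ∈ C) (hyV : y ∉ V) :
    ((V ⊔ Submodule.span F {y} : Submodule F E) : Set E) ⊆ C := by
  obtain ⟨hcard, hne⟩ := hC.ncard_eq hV hVrank
  have hcount := hC.kerCount_eq
  have hq : 2 ≤ Fintype.card F := Fintype.one_lt_card
  set q := Fintype.card F with hqdef
  set u := (q - 1) * q ^ d with hu
  have hqu : q ^ (d + 1) = q ^ d + u := by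
    obtain ⟨m, hm⟩ : ∃ m, q = m + 1 := ⟨q - 1, by omega⟩
    rw [hu, hm, Nat.add_sub_cancel]
    ring
  have hVC : (V : Set E) ⊆ C := hV ▸ fun v hv => hv.1
  set P := V ⊔ Submodule.span F {y} with hP
  have hyP : y ∈ P := Submodule.mem_sup_right (Submodule.mem_span_singleton_self y)
  have hVP : V ≤ P := le_sup_left
  have hy0 : y ≠ 0 := by
    rintro rfl
    exact hyV V.zero_mem
  have hPrank : finrank F P = d + 2 := by
    have h1 : finrank F P ≤ d + 2 := by
      have := Submodule.finrank_add_le_finrank_add_finrank V (Submodule.span F {y})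
      rwa [hVrank, finrank_span_singleton hy0] at this
    have h2 : finrank F V < finrank F P :=
      Submodule.finrank_lt_finrank_of_lt (lt_of_le_of_ne hVP fun h => hyV (h ▸ hyP))
    omega
  have hbig : ∀ g : Dual F E, g ≠ 0 → P ≤ LinearMap.ker g →
      kerCount C g = q ^ (d + 1) + 2 * q * u := by
    intro g hg0 hg
    rcases hcount g hg0 with h | h | h
    · exfalso
      have hsub : (V : Set E) ⊆ {v ∈ C | g v = 0} := fun v hv => ⟨hVC hv, hg (hVP hv)⟩
      have hlt : (V : Set E).ncard < kerCount C g :=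
        ncard_lt_ncard ((ssubset_iff_of_subset hsub).2 ⟨y, ⟨hy, hg hyP⟩, hyV⟩) (toFinite _)
      rw [ncard_submodule, hVrank, h] at hlt
      exact lt_irrefl _ hlt
    · exact absurd h (hne g hg0 (hVP.trans hg))
    · exact h
  obtain ⟨g₁, hg₁, hg₁0⟩ := exists_dual_ne P 0 (by rw [hPrank, hC.finrank_eq])
  replace hg₁0 : g₁ ≠ 0 := by simpa using hg₁0 0
  obtain ⟨g₂, hg₂, hg₂₁⟩ := exists_dual_ne P g₁ (by rw [hPrank, hC.finrank_eq])
  have hker : ¬ LinearMap.ker g₁ ≤ LinearMap.ker g₂ := by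
    intro h
    obtain ⟨r, hr⟩ := Submodule.mem_span_singleton.1
      (by simpa using mem_span_of_iInf_ker_le_ker (L := fun _ : Unit => g₁) (K := g₂) (by simpa))
    exact hg₂₁ r hr.symm
  have hPeq : P = LinearMap.ker g₁ ⊓ LinearMap.ker g₂ := by
    refine Submodule.eq_of_le_of_finrank_eq (le_inf hg₁ hg₂) ?_
    have h1 := finrank_inf_ker_add_one _ hker
    have h2 := Dual.finrank_ker_add_one_of_ne_zero hg₁0
    rw [hC.finrank_eq] at h2
    omega
  have haxis : {v ∈ C | g₁ v = 0 ∧ g₂ v = 0} = C ∩ P := by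
    rw [hPeq]
    rfl
  have hsum : ∀ t : F, kerCount C (g₂ + t • g₁) = q ^ (d + 1) + 2 * q * u := by
    intro t
    refine hbig _ (fun h => hg₂₁ (-t)
      ((eq_neg_of_add_eq_zero_left h).trans (neg_smul t g₁).symm)) fun v hv => ?_
    have h1 : g₁ v = 0 := hg₁ hv
    have h2 : g₂ v = 0 := hg₂ hv
    simp [h1, h2]
  have hpencil := card_add_kerCount_eq_sum C g₁ g₂
  rw [haxis, hbig g₁ hg₁0 hg₁, Finset.sum_congr rfl fun t _ => hsum t, hcard, Finset.sum_const,
    Finset.card_univ, smul_eq_mul, ← hqdef] at hpencil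
  have hw : (C ∩ P).ncard = q ^ (d + 2) := by
    refine Nat.eq_of_mul_eq_mul_left (show 0 < q by omega) ?_
    have h3 : q ^ (d + 2) = q * (q ^ d + u) := by rw [← hqu]; ring
    have h4 : q * q ^ d = q ^ d + u := by rw [← hqu]; ring
    rw [h3]
    rw [hqu] at hpencil
    zify at hpencil h4 ⊢
    linear_combination hpencil - q * h4
  have : C ∩ P = P := by
    refine eq_of_subset_of_ncard_le inter_subset_right ?_ (toFinite _)
    rw [hw, ncard_submodule, hPrank]
  rw [← this]
  exact inter_subset_left

theorem add_mem_iff (hC : IsThreeTypeCone F C d) {f : Dual F E}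
    {V : Submodule F E} (hV : (V : Set E) = {v ∈ C | f v = 0}) (hVrank : finrank F V = d + 1)
    {v e : E} (hv : v ∈ V) : v + e ∈ C ↔ e ∈ C := by
  have hVC : (V : Set E) ⊆ C := hV ▸ fun v hv => hv.1
  have key : ∀ {v e : E}, v ∈ V → e ∈ C → v + e ∈ C := by
    intro v e hv he
    by_cases heV : e ∈ V
    · exact hVC (V.add_mem hv heV)
    · exact hC.sup_span_subset hV hVrank he heV
        (Submodule.add_mem_sup hv (Submodule.mem_span_singleton_self e))
  refine ⟨fun h => ?_, key hv⟩
  simpa using key (V.neg_mem hv) h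

theorem ncard_inter_sup (hC : IsThreeTypeCone F C d) {f : Dual F E}
    {V : Submodule F E} (hV : (V : Set E) = {v ∈ C | f v = 0}) (hVrank : finrank F V = d + 1)
    {L : Submodule F E} (hL : Disjoint V L) :
    (C ∩ ((V ⊔ L : Submodule F E) : Set E)).ncard =
      Fintype.card F ^ (d + 1) * (C ∩ L).ncard := by
  have himage : C ∩ ((V ⊔ L : Submodule F E) : Set E) =
      (fun x : E × E => x.1 + x.2) '' ((V : Set E) ×ˢ (C ∩ L)) := by
    ext e
    simp only [mem_inter_iff, SetLike.mem_coe, Submodule.mem_sup, mem_image, mem_prod, Prod.exists]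
    constructor
    · rintro ⟨he, v, hv, l, hl, rfl⟩
      exact ⟨v, l, ⟨hv, (hC.add_mem_iff hV hVrank hv).1 he, hl⟩, rfl⟩
    · rintro ⟨v, l, ⟨hv, hlC, hl⟩, rfl⟩
      exact ⟨(hC.add_mem_iff hV hVrank hv).2 hlC, v, hv, l, hl, rfl⟩
  have hinj : InjOn (fun x : E × E => x.1 + x.2) ((V : Set E) ×ˢ (C ∩ L)) := by
    rintro ⟨v, l⟩ ⟨hv, -, hl⟩ ⟨v', l'⟩ ⟨hv', -, hl'⟩ h
    simp only [SetLike.mem_coe] at h hv hl hv' hl'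
    have hsub : v - v' = l' - l := by
      rw [sub_eq_sub_iff_add_eq_add, h, add_comm]
    have h0 : v - v' = 0 :=
      Submodule.disjoint_def.1 hL _ (V.sub_mem hv hv') (hsub ▸ L.sub_mem hl' hl)
    rw [h0] at hsub
    rw [sub_eq_zero.1 h0, sub_eq_zero.1 hsub.symm]
  rw [himage, hinj.ncard_image, ncard_prod, ncard_submodule, hVrank]

end IsThreeTypeCone

end Cone

theorem theta_mul_add_one {q : ℕ} (hq : 2 ≤ q) (m : ℕ) :
    theta q m * (q - 1) + 1 = q ^ (m + 1) := by
  have hdvd : q - 1 ∣ q ^ (m + 1) - 1 := by simpa using Nat.sub_dvd_pow_sub_pow q 1 (m + 1)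
  rw [theta, Nat.div_mul_cancel hdvd]
  exact Nat.sub_add_cancel (Nat.one_le_pow _ _ (by omega))

theorem exists_dual_ker_eq {F E : Type*} [Field F] [AddCommGroup E] [Module F E]
    [FiniteDimensional F E] (W : Submodule F E) (hW : finrank F W + 1 = finrank F E) :
    ∃ f : Dual F E, f ≠ 0 ∧ LinearMap.ker f = W := by
  have hlt : W < ⊤ := by
    refine lt_top_iff_ne_top.2 fun h => ?_
    rw [h, finrank_top] at hW
    omega
  obtain ⟨f, hf, hWf⟩ := W.exists_le_ker_of_lt_top hlt
  have := Dual.finrank_ker_add_one_of_ne_zero (f := f) hf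
  exact ⟨f, hf, (Submodule.eq_of_le_of_finrank_eq hWf (by omega)).symm⟩

theorem ncard_coneOf_inter {F : Type} [Field F] [Fintype F] {n : ℕ} (K : Set (PGPoint F n))
    (W : Submodule F (Fin (n + 1) → F)) :
    (coneOf K ∩ W).ncard = (K ∩ projSet F n W).ncard * (Fintype.card F - 1) + 1 := by
  rw [← coneOf_inter_submodule, ncard_coneOf]
  rfl

theorem rep_mem_iff {F : Type} [Field F] {n : ℕ} {W : Submodule F (Fin (n + 1) → F)}
    {p : PGPoint F n} : p.rep ∈ W ↔ p ∈ projSet F n W := by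
  rw [projSet, mem_ofPred_eq, Projectivization.submodule_eq, Submodule.span_singleton_le_iff_mem]

theorem isThreeTypeCone_coneOf {F : Type} [Field F] [Fintype F] {d : ℕ}
    {K : Set (PGPoint F (d + 3))} (hblock : BlocksDim F (d + 3) 2 K)
    (hK : IsType3 F (d + 3) K (theta (Fintype.card F) d)
      (theta (Fintype.card F) (d + 1) + Fintype.card F ^ d)
      (theta (Fintype.card F) (d + 1) + Fintype.card F ^ (d + 1))) :
    IsThreeTypeCone F (coneOf K) d where
  finrank_eq := by simp
  zero_mem := zero_mem_coneOf K
  smul_mem := fun r _ hv => smul_mem_coneOf r hv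
  blocks := by
    intro W hW
    obtain ⟨p, hpK, hpW⟩ := hblock W hW
    exact ⟨p.rep, rep_mem_coneOf.2 hpK, rep_mem_iff.2 hpW, p.rep_nonzero⟩
  kerCount_eq := by
    intro f hf
    have hq : 2 ≤ Fintype.card F := Fintype.one_lt_card
    have hker := Dual.finrank_ker_add_one_of_ne_zero hf
    have hcount : kerCount (coneOf K) f = _ := ncard_coneOf_inter K (LinearMap.ker f)
    have hθ := theta_mul_add_one hq d
    have hθ' := theta_mul_add_one hq (d + 1)
    have hW := hK.1 (LinearMap.ker f) (by simpa using hker)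
    rw [hcount]
    set q := Fintype.card F
    obtain ⟨m, hm⟩ : ∃ m, q = m + 1 := ⟨q - 1, by omega⟩
    rw [hm, Nat.add_sub_cancel] at hθ hθ' ⊢
    rcases hW with h | h | h
    · left
      rw [h, hm, hθ]
    · right; left
      rw [h, hm, add_mul, add_right_comm, hθ']
      ring
    · right; right
      rw [h, hm, add_mul, add_right_comm, hθ']
      ring

theorem exists_hyperoval_cone {F : Type} [Field F] [Fintype F] {d : ℕ}
    {K : Set (PGPoint F (d + 3))} (hC : IsThreeTypeCone F (coneOf K) d)
    {f : Dual F (Fin (d + 3 + 1) → F)} {V : Submodule F (Fin (d + 3 + 1) → F)}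
    (hV : (V : Set (Fin (d + 3 + 1) → F)) = {v ∈ coneOf K | f v = 0})
    (hVrank : finrank F V = d + 1) :
    ∃ T : Submodule F (Fin (d + 3 + 1) → F),
      finrank F T = 3 ∧ V ⊓ T = ⊥ ∧ projSet F (d + 3) V ⊆ K ∧
      IsHyperoval F (d + 3) (Fintype.card F) T (K ∩ projSet F (d + 3) T) ∧
      K = projSet F (d + 3) V ∪
        ⋃ y ∈ K ∩ projSet F (d + 3) T, ⋃ x ∈ projSet F (d + 3) V,
          projSet F (d + 3) (x.submodule ⊔ y.submodule) := by
  obtain ⟨hcard, hne⟩ := hC.ncard_eq hV hVrank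
  obtain ⟨T, hT⟩ := V.exists_isCompl
  have hVC : ∀ {v}, v ∈ V → v ∈ coneOf K := fun {v} hv =>
    (hV ▸ hv : v ∈ {v ∈ coneOf K | f v = 0}).1
  have hVK : projSet F (d + 3) V ⊆ K := fun p hp =>
    rep_mem_coneOf.1 (hVC (rep_mem_iff.2 hp))
  have hTrank : finrank F T = 3 := by
    have := Submodule.finrank_add_eq_of_isCompl hT
    rw [hVrank, hC.finrank_eq] at this
    omega
  have hq : 2 ≤ Fintype.card F := Fintype.one_lt_card
  obtain ⟨m, hm⟩ : ∃ m, Fintype.card F = m + 1 := ⟨Fintype.card F - 1, by omega⟩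
  have hm0 : 0 < m := by omega
  have hpow : 0 < (m + 1) ^ (d + 1) := by positivity
  have hsection : ∀ L ≤ T,
      (coneOf K ∩ ((V ⊔ L : Submodule F (Fin (d + 3 + 1) → F)) : Set _)).ncard =
        (m + 1) ^ (d + 1) * ((K ∩ projSet F (d + 3) L).ncard * m + 1) := by
    intro L hL
    rw [hC.ncard_inter_sup hV hVrank (hT.disjoint.mono_right hL), ncard_coneOf_inter, hm,
      Nat.add_sub_cancel]
  refine ⟨T, hTrank, hT.inf_eq_bot, hVK, ⟨inter_subset_right, ?_, ?_⟩, ?_⟩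
  · have h := hsection T le_rfl
    rw [hT.sup_eq_top, Submodule.top_coe, inter_univ, hcard, hm, Nat.add_sub_cancel] at h
    have h' : (m + 1) ^ (d + 1) * ((m + 1 + 2) * m + 1) =
        (m + 1) ^ (d + 1) * ((K ∩ projSet F (d + 3) T).ncard * m + 1) := by
      rw [← h]
      ring
    rw [hm]
    exact (Nat.eq_of_mul_eq_mul_right hm0
      (Nat.add_right_cancel (Nat.eq_of_mul_eq_mul_left hpow h'))).symm
  · intro L hL hLrank
    have hrank : finrank F ↥(V ⊔ L) = d + 3 := by
      have := Submodule.finrank_sup_add_finrank_inf_eq V L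
      rw [(hT.disjoint.mono_right hL).eq_bot, finrank_bot, hVrank, hLrank] at this
      omega
    obtain ⟨g, hg0, hg⟩ := exists_dual_ker_eq (V ⊔ L) (by rw [hrank, hC.finrank_eq])
    have hkc : kerCount (coneOf K) g =
        (m + 1) ^ (d + 1) * ((K ∩ projSet F (d + 3) L).ncard * m + 1) := by
      rw [← hsection L hL, ← hg]
      rfl
    have hinter : K ∩ projSet F (d + 3) T ∩ projSet F (d + 3) L = K ∩ projSet F (d + 3) L := by
      have hsub : projSet F (d + 3) L ⊆ projSet F (d + 3) T :=
        fun p hp => rep_mem_iff.1 (hL (rep_mem_iff.2 hp))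
      rw [inter_assoc, inter_eq_right.2 hsub]
    rw [hinter]
    rcases hC.kerCount_eq g hg0 with h | h | h
    · left
      rw [hkc, hm] at h
      have := Nat.eq_of_mul_eq_mul_left hpow (h.trans (mul_one _).symm)
      simpa [hm0.ne'] using this
    · exact absurd h (hne g hg0 (hg ▸ le_sup_left))
    · right
      rw [hkc, hm, Nat.add_sub_cancel] at h
      have h' : (m + 1) ^ (d + 1) * ((K ∩ projSet F (d + 3) L).ncard * m + 1) =
          (m + 1) ^ (d + 1) * (2 * m + 1) := by
        rw [h]
        ring
      exact Nat.eq_of_mul_eq_mul_right hm0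
        (Nat.add_right_cancel (Nat.eq_of_mul_eq_mul_left hpow h'))
  · ext p
    simp only [mem_union, mem_iUnion, exists_prop]
    constructor
    · intro hp
      by_cases hpV : p ∈ projSet F (d + 3) V
      · exact Or.inl hpV
      right
      have htop : p.rep ∈ V ⊔ T := hT.sup_eq_top ▸ Submodule.mem_top
      obtain ⟨v, hv, t, ht, hvt⟩ := Submodule.mem_sup.1 htop
      have ht0 : t ≠ 0 := by
        rintro rfl
        rw [add_zero] at hvt
        exact hpV (rep_mem_iff.1 (hvt ▸ hv))
      have htC : t ∈ coneOf K :=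
        (hC.add_mem_iff hV hVrank hv).1 (hvt ▸ rep_mem_coneOf.2 hp)
      obtain ⟨w, hw, hw0, hvw⟩ : ∃ w ∈ V, w ≠ 0 ∧ v ∈ Submodule.span F {w} := by
        by_cases hv0 : v = 0
        · have hVbot : V ≠ ⊥ := by
            rintro rfl
            simp at hVrank
          obtain ⟨w, hw, hw0⟩ := Submodule.exists_mem_ne_zero_of_ne_bot hVbot
          exact ⟨w, hw, hw0, hv0 ▸ Submodule.zero_mem _⟩
        · exact ⟨v, hv, hv0, Submodule.mem_span_singleton_self v⟩
      refine ⟨Projectivization.mk F t ht0, ⟨htC ht0, ?_⟩, Projectivization.mk F w hw0, ?_, ?_⟩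
      · simpa [projSet, Projectivization.submodule_mk] using ht
      · simpa [projSet, Projectivization.submodule_mk] using hw
      · rw [← rep_mem_iff, Projectivization.submodule_mk, Projectivization.submodule_mk, ← hvt]
        exact Submodule.add_mem_sup hvw (Submodule.mem_span_singleton_self t)
    · rintro (hp | ⟨y, ⟨hyK, -⟩, x, hx, hp⟩)
      · exact hVK hp
      · rw [← rep_mem_iff, Projectivization.submodule_eq y] at hp
        obtain ⟨v, hv, t, ht, hvt⟩ := Submodule.mem_sup.1 hp
        obtain ⟨r, rfl⟩ := Submodule.mem_span_singleton.1 ht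
        rw [← rep_mem_coneOf, ← hvt]
        exact (hC.add_mem_iff hV hVrank (hx hv)).2 (smul_mem_coneOf r (rep_mem_coneOf.2 hyK))

/-- In `PG(n,q)`, `n ≥ 4`, every plane blocking set of type
`(θ_{n-3}, θ_{n-2} + q^{n-3}, θ_{n-2} + q^{n-2})_{n-1}` is a hyperoval cone:
there are an `(n-3)`-dimensional subspace `V ⊆ K` and a plane `τ` disjoint from `V`
such that `K ∩ τ` is a hyperoval of `τ` and `K` is the union of `V` together with all
points on lines joining a point of `V` to a point of `K ∩ τ`. -/
theorem statement11 [Fintype F] (q n : ℕ) (hq : Fintype.card F = q) (hn : 4 ≤ n)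
    (K : Set (PGPoint F n)) (hblock : BlocksDim F n 2 K)
    (hK : IsType3 F n K (theta q (n - 3)) (theta q (n - 2) + q ^ (n - 3))
      (theta q (n - 2) + q ^ (n - 2))) :
    ∃ Wv Wt : Submodule F (Fin (n + 1) → F),
      finrank F Wv = n - 2 ∧ finrank F Wt = 3 ∧ Wv ⊓ Wt = ⊥ ∧
      projSet F n Wv ⊆ K ∧
      IsHyperoval F n q Wt (K ∩ projSet F n Wt) ∧
      K = projSet F n Wv ∪
        ⋃ y ∈ K ∩ projSet F n Wt, ⋃ x ∈ projSet F n Wv,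
          projSet F n (x.submodule ⊔ y.submodule) := by
  obtain ⟨d, rfl⟩ : ∃ d, n = d + 3 := ⟨n - 3, by omega⟩
  subst hq
  have hC : IsThreeTypeCone F (coneOf K) d := isThreeTypeCone_coneOf hblock hK
  obtain ⟨W, hW, hWK⟩ := hK.2.1
  obtain ⟨f, hf, rfl⟩ := exists_dual_ker_eq W (by rw [hW, hC.finrank_eq])
  have hkc : kerCount (coneOf K) f = Fintype.card F ^ (d + 1) := by
    rw [← theta_mul_add_one Fintype.one_lt_card]
    exact (ncard_coneOf_inter K (LinearMap.ker f)).trans (by rw [hWK]; rfl)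
  obtain ⟨V, hV, hVrank⟩ := hC.exists_vertex hf hkc
  obtain ⟨T, hT⟩ := exists_hyperoval_cone hC hV hVrank
  exact ⟨V, T, hVrank, hT⟩
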